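/- Assume in addition that the characteristic of K is not 2. Let A = K[x,y]/((y − x²)(y + x²)) be the coordinate ring of the singular plane curve (y − x²)(y + x²) = 0, and fix r ∈ (0,1]. Then the assignments [f]₁ = |f(x, x²)|_r and [f]₂ = |f(x, −x²)|_r (where on univariate polynomials |Σᵢ aᵢ xⁱ|_r = maxᵢ |aᵢ| rⁱ) both vanish on the ideal ((y − x²)(y + x²)) and hence define multiplicative seminorms on A compatible with |·|; they agree on the residue class of every affine-linear polynomial ax + by + c (both equal max(|a|r, |b|r², |c|)), yet they are distinct, since [y − x²]₁ = 0 while [y − x²]₂ = |2| r² > 0. In particular, for this singular curve X the canonical map from X^an to the inverse limit of linear tropicalizations of X is not injective. -/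

import Mathlib

open MvPolynomial

/-- A multiplicative seminorm on a commutative ring, with values in `ℝ` (nonnegative). -/
def IsMultSeminorm {A : Type*} [CommRing A] (p : A → ℝ) : Prop :=
  (∀ f, 0 ≤ p f) ∧ p 0 = 0 ∧ p 1 = 1 ∧ (∀ f g, p (f * g) = p f * p g) ∧
    (∀ f g, p (f + g) ≤ p f + p g)

/-- Compatibility of a multiplicative seminorm with the absolute value on the base field. -/
def IsCompatible {K A : Type*} [Field K] [CommRing A] [Algebra K A]
    (v : AbsoluteValue K ℝ) (p : A → ℝ) : Prop :=
  ∀ a : K, p (algebraMap K A a) = v a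

/-- `log : ℝ≥0 → ℝ ∪ {−∞}`, sending `0` to `−∞`. -/
noncomputable def elog (x : ℝ) : EReal := if x = 0 then ⊥ else (Real.log x : EReal)

/-- The valuation `ν = log |·| : K → ℝ ∪ {−∞}`, with `ν 0 = −∞`. -/
noncomputable def nu {K : Type*} [Field K] (v : AbsoluteValue K ℝ) (a : K) : EReal :=
  elog (v a)

/-- The Gauss norm `|Σ aᵢ xⁱ|_r = maxᵢ |aᵢ| rⁱ` on univariate polynomials. -/
noncomputable def gaussNorm {K : Type*} [Field K] (v : AbsoluteValue K ℝ) (r : ℝ)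
    (p : Polynomial K) : ℝ :=
  (Finset.range (p.natDegree + 1)).sup' (Finset.nonempty_range_iff.mpr (Nat.succ_ne_zero _))
    fun i => v (p.coeff i) * r ^ i

/-- The defining polynomial `(y − x²)(y + x²)` of the singular plane curve. -/
noncomputable def curvePoly (K : Type*) [Field K] : MvPolynomial (Fin 2) K :=
  (MvPolynomial.X 1 - MvPolynomial.X 0 ^ 2) * (MvPolynomial.X 1 + MvPolynomial.X 0 ^ 2)

/-- The seminorm `f ↦ |f(x, x²)|_r` on `K[x,y]`. -/
noncomputable def semPlus {K : Type*} [Field K] (v : AbsoluteValue K ℝ) (r : ℝ)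
    (f : MvPolynomial (Fin 2) K) : ℝ :=
  gaussNorm v r (MvPolynomial.aeval ![Polynomial.X, Polynomial.X ^ 2] f)

/-- The seminorm `f ↦ |f(x, −x²)|_r` on `K[x,y]`. -/
noncomputable def semMinus {K : Type*} [Field K] (v : AbsoluteValue K ℝ) (r : ℝ)
    (f : MvPolynomial (Fin 2) K) : ℝ :=
  gaussNorm v r (MvPolynomial.aeval ![Polynomial.X, -(Polynomial.X ^ 2)] f)

theorem gaussNorm_eq_polynomial_gaussNorm {K : Type*} [Field K] (v : AbsoluteValue K ℝ) {r : ℝ}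
    (hr : 0 ≤ r) (p : Polynomial K) : gaussNorm v r p = p.gaussNorm v r := by
  apply le_antisymm
  · exact Finset.sup'_le _ _ fun i _ => p.le_gaussNorm v hr i
  · obtain ⟨i, hi⟩ := p.exists_eq_gaussNorm v r
    rw [hi]
    by_cases hd : i ≤ p.natDegree
    · exact Finset.le_sup' (fun i => v (p.coeff i) * r ^ i)
        (Finset.mem_range.mpr (Nat.lt_succ_of_le hd))
    · rw [Polynomial.coeff_eq_zero_of_natDegree_lt (not_le.mp hd), map_zero, zero_mul]
      exact (mul_nonneg (v.nonneg _) (pow_nonneg hr 0)).trans <|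
        Finset.le_sup' (fun i => v (p.coeff i) * r ^ i) (Finset.mem_range.mpr (Nat.succ_pos _))

theorem gaussNorm_zero {K : Type*} [Field K] (v : AbsoluteValue K ℝ) (r : ℝ) :
    gaussNorm v r 0 = 0 := by
  simp [gaussNorm]

theorem isMultSeminorm_gaussNorm_comp {K A : Type*} [Field K] [CommRing A]
    (v : AbsoluteValue K ℝ) (hna : IsNonarchimedean v) {r : ℝ} (hr : 0 < r)
    (φ : A →+* Polynomial K) : IsMultSeminorm fun f => gaussNorm v r (φ f) := by
  have := Polynomial.gaussNorm_isAbsoluteValue hna hr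
  simp only [gaussNorm_eq_polynomial_gaussNorm v hr.le]
  refine ⟨fun f => Polynomial.gaussNorm_nonneg v _ hr.le, by simp, ?_, fun f g => ?_, fun f g => ?_⟩
  · beta_reduce
    rw [map_one, ← Polynomial.C_1, Polynomial.gaussNorm_C, map_one]
  · beta_reduce
    rw [map_mul, Polynomial.gaussNorm_mul hna hr]
  · beta_reduce
    rw [map_add]
    exact IsAbsoluteValue.abv_add (Polynomial.gaussNorm v r) _ _

theorem isCompatible_gaussNorm_comp {K A : Type*} [Field K] [CommRing A] [Algebra K A]
    (v : AbsoluteValue K ℝ) {r : ℝ} (hr : 0 ≤ r) (φ : A →ₐ[K] Polynomial K) :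
    IsCompatible v fun f => gaussNorm v r (φ f) := fun a => by
  simp [gaussNorm_eq_polynomial_gaussNorm v hr, Polynomial.algebraMap_eq]

theorem gaussNorm_quadratic {K : Type*} [Field K] (v : AbsoluteValue K ℝ) {r : ℝ} (hr : 0 ≤ r)
    (a b c : K) :
    gaussNorm v r (Polynomial.C a * Polynomial.X + Polynomial.C b * Polynomial.X ^ 2 +
      Polynomial.C c) = max (v a * r) (max (v b * r ^ 2) (v c)) := by
  set p := Polynomial.C a * Polynomial.X + Polynomial.C b * Polynomial.X ^ 2 + Polynomial.C c
    with hp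
  have h0 : p.coeff 0 = c := by simp [hp]
  have h1 : p.coeff 1 = a := by simp [hp, Polynomial.coeff_X_pow, Polynomial.coeff_C]
  have h2 : p.coeff 2 = b := by simp [hp]
  have h3 (n : ℕ) : p.coeff (n + 3) = 0 := by
    simp [hp]
  rw [gaussNorm_eq_polynomial_gaussNorm v hr]
  apply le_antisymm
  · obtain ⟨i, hi⟩ := p.exists_eq_gaussNorm v r
    rw [hi]
    match i with
    | 0 => simp [h0]
    | 1 => simp [h1]
    | 2 => simp [h2]
    | n + 3 =>
      rw [h3, map_zero, zero_mul]
      exact (mul_nonneg (v.nonneg a) hr).trans (le_max_left _ _)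
  · refine max_le ?_ (max_le ?_ ?_)
    · simpa [h1] using p.le_gaussNorm v hr 1
    · simpa [h2] using p.le_gaussNorm v hr 2
    · simpa [h0] using p.le_gaussNorm v hr 0

theorem map_eq_zero_of_mem_span_curvePoly {K A : Type*} [Field K] [CommRing A]
    (φ : MvPolynomial (Fin 2) K →+* A) (hφ : φ (curvePoly K) = 0) :
    ∀ g ∈ Ideal.span {curvePoly K}, φ g = 0 := fun g hg => by
  obtain ⟨h, rfl⟩ := Ideal.mem_span_singleton'.mp hg
  rw [map_mul, hφ, mul_zero]

/-- For the singular plane curve `(y − x²)(y + x²) = 0` (char K ≠ 2), the two seminorms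
`|f(x, x²)|_r` and `|f(x, −x²)|_r` descend to distinct multiplicative seminorms on the
coordinate ring which agree on all affine-linear polynomials; hence the canonical map from
`X^an` to the inverse limit of linear tropicalizations is not injective. -/
theorem statement_7 {K : Type*} [Field K] [IsAlgClosed K] [MetricSpace K] [CompleteSpace K]
    (v : AbsoluteValue K ℝ)
    (hna : ∀ a b : K, v (a + b) ≤ max (v a) (v b))
    (hnt : ∃ a : K, a ≠ 0 ∧ v a ≠ 1)
    (hdist : ∀ a b : K, dist a b = v (a - b))
    (hchar : (2 : K) ≠ 0)
    (r : ℝ) (hr0 : 0 < r) (hr1 : r ≤ 1) :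
    (∀ g ∈ Ideal.span {curvePoly K}, semPlus v r g = 0 ∧ semMinus v r g = 0) ∧
    ∃ q₁ q₂ : (MvPolynomial (Fin 2) K ⧸ Ideal.span {curvePoly K}) → ℝ,
      (∀ f : MvPolynomial (Fin 2) K,
        q₁ (Ideal.Quotient.mk (Ideal.span {curvePoly K}) f) = semPlus v r f) ∧
      (∀ f : MvPolynomial (Fin 2) K,
        q₂ (Ideal.Quotient.mk (Ideal.span {curvePoly K}) f) = semMinus v r f) ∧
      IsMultSeminorm q₁ ∧ IsCompatible v q₁ ∧ IsMultSeminorm q₂ ∧ IsCompatible v q₂ ∧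
      (∀ a b c : K,
        q₁ (Ideal.Quotient.mk (Ideal.span {curvePoly K})
            (C a * MvPolynomial.X 0 + C b * MvPolynomial.X 1 + C c)) =
          max (v a * r) (max (v b * r ^ 2) (v c)) ∧
        q₂ (Ideal.Quotient.mk (Ideal.span {curvePoly K})
            (C a * MvPolynomial.X 0 + C b * MvPolynomial.X 1 + C c)) =
          max (v a * r) (max (v b * r ^ 2) (v c))) ∧
      q₁ (Ideal.Quotient.mk (Ideal.span {curvePoly K})
          (MvPolynomial.X 1 - MvPolynomial.X 0 ^ 2)) = 0 ∧
      q₂ (Ideal.Quotient.mk (Ideal.span {curvePoly K})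
          (MvPolynomial.X 1 - MvPolynomial.X 0 ^ 2)) = v 2 * r ^ 2 ∧
      0 < v 2 * r ^ 2 ∧
      q₁ ≠ q₂ := by
  set I := Ideal.span {curvePoly K}
  let φ₁ : MvPolynomial (Fin 2) K →ₐ[K] Polynomial K :=
    MvPolynomial.aeval ![Polynomial.X, Polynomial.X ^ 2]
  let φ₂ : MvPolynomial (Fin 2) K →ₐ[K] Polynomial K :=
    MvPolynomial.aeval ![Polynomial.X, -(Polynomial.X ^ 2)]
  have h₁ : ∀ g ∈ I, φ₁ g = 0 :=
    map_eq_zero_of_mem_span_curvePoly φ₁.toRingHom (by simp [φ₁, curvePoly])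
  have h₂ : ∀ g ∈ I, φ₂ g = 0 :=
    map_eq_zero_of_mem_span_curvePoly φ₂.toRingHom (by simp [φ₂, curvePoly])
  have hpos : 0 < v 2 * r ^ 2 := mul_pos (v.pos hchar) (pow_pos hr0 2)
  have hq₁ : gaussNorm v r (φ₁ (MvPolynomial.X 1 - MvPolynomial.X 0 ^ 2)) = 0 := by
    simp [φ₁, gaussNorm_zero]
  have hq₂ : gaussNorm v r (φ₂ (MvPolynomial.X 1 - MvPolynomial.X 0 ^ 2)) = v 2 * r ^ 2 := by
    have h : φ₂ (MvPolynomial.X 1 - MvPolynomial.X 0 ^ 2) = Polynomial.monomial 2 (-2) := by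
      simp only [map_sub, aeval_X, map_pow, φ₂, ← Polynomial.C_mul_X_pow_eq_monomial, map_neg,
        Matrix.cons_val_one, Matrix.cons_val_zero, Polynomial.C_ofNat]
      ring
    rw [h, gaussNorm_eq_polynomial_gaussNorm v hr0.le, Polynomial.gaussNorm_monomial, v.map_neg]
  refine ⟨fun g hg => ⟨?_, ?_⟩, fun z => gaussNorm v r (Ideal.Quotient.liftₐ I φ₁ h₁ z),
    fun z => gaussNorm v r (Ideal.Quotient.liftₐ I φ₂ h₂ z), fun f => rfl, fun f => rfl,
    isMultSeminorm_gaussNorm_comp v hna hr0 (Ideal.Quotient.liftₐ I φ₁ h₁).toRingHom,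
    isCompatible_gaussNorm_comp v hr0.le _,
    isMultSeminorm_gaussNorm_comp v hna hr0 (Ideal.Quotient.liftₐ I φ₂ h₂).toRingHom,
    isCompatible_gaussNorm_comp v hr0.le _, fun a b c => ⟨?_, ?_⟩, hq₁, hq₂, hpos, fun h => ?_⟩
  · exact (congrArg (gaussNorm v r) (h₁ g hg)).trans (gaussNorm_zero v r)
  · exact (congrArg (gaussNorm v r) (h₂ g hg)).trans (gaussNorm_zero v r)
  · rw [← gaussNorm_quadratic v hr0.le]
    exact congrArg (gaussNorm v r) (show φ₁ (C a * X 0 + C b * X 1 + C c) = _ by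
      simp [φ₁, Polynomial.algebraMap_eq])
  · rw [← v.map_neg b, ← gaussNorm_quadratic v hr0.le]
    exact congrArg (gaussNorm v r) (show φ₂ (C a * X 0 + C b * X 1 + C c) = _ by
      simp [φ₂, Polynomial.algebraMap_eq])
  · have h' := congrFun h (Ideal.Quotient.mk I (MvPolynomial.X 1 - MvPolynomial.X 0 ^ 2))
    exact hpos.ne (hq₁.symm.trans (h'.trans hq₂))
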